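/- If G is a triangle-free connected graph in G^cs that is not a cycle, then diam(G) ≤ 3. -/

import Mathlib

open SimpleGraph
open scoped Classical

variable {V : Type*} [Fintype V]

noncomputable def setWeight (w : V → ℝ) (A : Set V) : ℝ :=
  ∑ v : V, if v ∈ A then w v else 0

def IsComponentOf (G : SimpleGraph V) (S C : Set V) : Prop :=
  ∃ c : (G.induce S).ConnectedComponent,
    C = Subtype.val '' {x : ↥S | (G.induce S).connectedComponentMk x = c}

def Touches (G : SimpleGraph V) (C D : Set V) : Prop :=
  ∃ a ∈ C, ∃ b ∈ D, G.Adj a b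

def IsSafeSet (G : SimpleGraph V) (w : V → ℝ) (S : Set V) : Prop :=
  S.Nonempty ∧ S ≠ Set.univ ∧
    ∀ C D : Set V, IsComponentOf G S C → IsComponentOf G Sᶜ D → Touches G C D →
      setWeight w D ≤ setWeight w C

def IsConnSafeSet (G : SimpleGraph V) (w : V → ℝ) (S : Set V) : Prop :=
  IsSafeSet G w S ∧ (G.induce S).Connected

noncomputable def safeNumber (G : SimpleGraph V) (w : V → ℝ) : ℝ :=
  sInf (setWeight w '' {S | IsSafeSet G w S})

noncomputable def connSafeNumber (G : SimpleGraph V) (w : V → ℝ) : ℝ :=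
  sInf (setWeight w '' {S | IsConnSafeSet G w S})

def InGcs (G : SimpleGraph V) : Prop :=
  ∀ w : V → ℝ, (∀ v, 0 < w v) → safeNumber G w = connSafeNumber G w

/-- The graph `G` restricted to edges inside `S`. -/
def gr (G : SimpleGraph V) (S : Set V) : SimpleGraph V where
  Adj u v := u ∈ S ∧ v ∈ S ∧ G.Adj u v
  symm := ⟨fun _ _ h => ⟨h.2.1, h.1, h.2.2.symm⟩⟩
  loopless := ⟨fun _ h => G.loopless.irrefl _ h.2.2⟩

/-- `a` and `b` are joined inside `S`. -/
def J (G : SimpleGraph V) (S : Set V) (a b : V) : Prop := (gr G S).Reachable a b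

def Conn (G : SimpleGraph V) (S : Set V) : Prop :=
  S.Nonempty ∧ ∀ a ∈ S, ∀ b ∈ S, J G S a b

theorem J.refl {G : SimpleGraph V} {S : Set V} (a : V) : J G S a a := Reachable.refl a

theorem J.symm {G : SimpleGraph V} {S : Set V} {a b : V} (h : J G S a b) : J G S b a :=
  Reachable.symm h

theorem J.trans {G : SimpleGraph V} {S : Set V} {a b c : V} (h : J G S a b) (h' : J G S b c) :
    J G S a c := Reachable.trans h h'

theorem J.adj {G : SimpleGraph V} {S : Set V} {a b : V} (ha : a ∈ S) (hb : b ∈ S)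
    (h : G.Adj a b) : J G S a b :=
  SimpleGraph.Adj.reachable (G := gr G S) ⟨ha, hb, h⟩

theorem gr_mono {G : SimpleGraph V} {S T : Set V} (h : S ⊆ T) : gr G S ≤ gr G T :=
  fun _ _ hh => ⟨h hh.1, h hh.2.1, hh.2.2⟩

theorem J.mono {G : SimpleGraph V} {S T : Set V} {a b : V} (h : J G S a b) (hST : S ⊆ T) :
    J G T a b := Reachable.mono (gr_mono hST) h

/-- closed sets contain everything joined -/
theorem J.closed {G : SimpleGraph V} {S : Set V} {a b : V} (h : J G S a b) (P : V → Prop)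
    (ha : P a) (hP : ∀ u v, u ∈ S → v ∈ S → G.Adj u v → P u → P v) : P b := by
  obtain ⟨p⟩ := h
  induction p with
  | nil => exact ha
  | cons hadj p ih => exact ih (hP _ _ hadj.1 hadj.2.1 hadj.2.2 ha)

theorem J.mem {G : SimpleGraph V} {S : Set V} {a b : V} (h : J G S a b) (ha : a ∈ S) : b ∈ S :=
  h.closed (· ∈ S) ha (fun _ _ _ h _ _ => h)

/-- being joined inside S where everything stays in T -/
theorem J.within {G : SimpleGraph V} {S T : Set V} {a b : V} (h : J G S a b)
    (hT : ∀ x, J G S a x → x ∈ T) : J G T a b := by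
  have : J G S a b ∧ J G T a b := by
    refine h.closed (fun x => J G S a x ∧ J G T a x) ⟨J.refl _, J.refl _⟩ ?_
    rintro u v hu hv huv ⟨h1, h2⟩
    have h3 := h1.trans (J.adj hu hv huv)
    exact ⟨h3, h2.trans (J.adj (hT _ h1) (hT _ h3) huv)⟩
  exact this.2

theorem conn_comp (G : SimpleGraph V) {S : Set V} (a : V) : Conn G {x | J G S a x} := by
  refine ⟨⟨a, J.refl a⟩, fun x hx y hy => ?_⟩
  have h1 : J G {x | J G S a x} a x := J.within hx (fun _ h => h)
  have h2 : J G {x | J G S a x} a y := J.within hy (fun _ h => h)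
  exact h1.symm.trans h2

theorem conn_of_root {G : SimpleGraph V} {S : Set V} (a : V) (ha : a ∈ S)
    (h : ∀ x ∈ S, J G S a x) : Conn G S :=
  ⟨⟨a, ha⟩, fun x hx y hy => (h x hx).symm.trans (h y hy)⟩

theorem conn_singleton (G : SimpleGraph V) (a : V) : Conn G {a} :=
  conn_of_root a rfl (by rintro x rfl; exact J.refl _)

theorem conn_union {G : SimpleGraph V} {A B : Set V} (hA : Conn G A) (hB : Conn G B) {a b : V}
    (ha : a ∈ A) (hb : b ∈ B) (hab : G.Adj a b) : Conn G (A ∪ B) := by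
  refine conn_of_root a (Or.inl ha) ?_
  rintro x (hx | hx)
  · exact (hA.2 a ha x hx).mono Set.subset_union_left
  · exact (J.adj (Set.mem_union_left B ha) (Set.mem_union_right A hb) hab).trans
      ((hB.2 b hb x hx).mono Set.subset_union_right)

theorem conn_star {G : SimpleGraph V} {A : Set V} {c : V} (hA : ∀ a ∈ A, G.Adj c a) :
    Conn G (insert c A) := by
  refine conn_of_root c (Set.mem_insert _ _) ?_
  rintro x (rfl | hx)
  · exact J.refl _
  · exact J.adj (Set.mem_insert _ _) (Or.inr hx) (hA x hx)

theorem conn_insert {G : SimpleGraph V} {A : Set V} (hA : Conn G A) {a b : V}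
    (ha : a ∈ A) (hab : G.Adj b a) : Conn G (insert b A) := by
  have := conn_union (conn_singleton G b) hA rfl ha hab
  rwa [Set.singleton_union] at this

theorem reach_induce {G : SimpleGraph V} {S : Set V} (x y : S) :
    (G.induce S).Reachable x y ↔ J G S x y := by
  constructor
  · rintro ⟨p⟩
    induction p with
    | nil => exact J.refl _
    | cons h p ih => exact (J.adj (Subtype.prop _) (Subtype.prop _) h).trans ih
  · intro h
    have : ∃ h : (y : V) ∈ S, (G.induce S).Reachable x ⟨y, h⟩ := by
      refine h.closed (fun z => ∃ h : z ∈ S, (G.induce S).Reachable x ⟨z, h⟩)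
        ⟨x.2, Reachable.refl _⟩ ?_
      rintro u v hu hv huv ⟨_, h2⟩
      exact ⟨hv, h2.trans (SimpleGraph.Adj.reachable huv)⟩
    exact this.2

theorem conn_iff {G : SimpleGraph V} {S : Set V} : (G.induce S).Connected ↔ Conn G S := by
  constructor
  · intro h
    have := h.nonempty
    obtain ⟨a⟩ := this
    exact ⟨⟨a, a.2⟩, fun x hx y hy => (reach_induce ⟨x, hx⟩ ⟨y, hy⟩).1 (h.preconnected _ _)⟩
  · rintro ⟨⟨a, ha⟩, h⟩
    haveI : Nonempty S := ⟨⟨a, ha⟩⟩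
    exact ⟨fun x y => (reach_induce x y).2 (h x x.2 y y.2)⟩

theorem isComp_iff {G : SimpleGraph V} {S C : Set V} :
    IsComponentOf G S C ↔ ∃ a ∈ S, C = {x | J G S a x} := by
  have key : ∀ a : S, (Subtype.val '' {x : ↥S | (G.induce S).connectedComponentMk x =
      (G.induce S).connectedComponentMk a}) = {x | J G S a x} := by
    intro a
    ext x
    constructor
    · rintro ⟨y, hy, rfl⟩
      exact (reach_induce _ _).1 (ConnectedComponent.exact hy).symm
    · intro hx
      exact ⟨⟨x, J.mem hx a.2⟩, ConnectedComponent.sound ((reach_induce a ⟨x, J.mem hx a.2⟩).2 hx).symm, rfl⟩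
  constructor
  · rintro ⟨c, rfl⟩
    induction c using ConnectedComponent.ind with
    | h v => exact ⟨v, v.2, key v⟩
  · rintro ⟨a, ha, rfl⟩
    exact ⟨(G.induce S).connectedComponentMk ⟨a, ha⟩, (key ⟨a, ha⟩).symm⟩

/-- A nontrivial set in a connected graph has an edge leaving. -/
theorem exists_edge {G : SimpleGraph V} (hG : G.Connected) {T : Set V} {a b : V} (ha : a ∈ T)
    (hb : b ∉ T) : ∃ u ∈ T, ∃ v ∉ T, G.Adj u v := by
  by_contra hcon
  push Not at hcon
  obtain ⟨p⟩ := hG.preconnected a b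
  induction p with
  | nil => exact hb ha
  | cons h p ih =>
    exact ih (by by_contra h2; exact hcon _ ha _ h2 h) hb

theorem sw_mono {w : V → ℝ} (hw : ∀ v, 0 < w v) {A B : Set V} (h : A ⊆ B) :
    setWeight w A ≤ setWeight w B := by
  unfold setWeight
  refine Finset.sum_le_sum fun v _ => ?_
  by_cases hA : v ∈ A
  · simp [hA, h hA]
  · by_cases hB : v ∈ B <;> simp [hA, hB, (hw v).le]

theorem sw_nonneg {w : V → ℝ} (hw : ∀ v, 0 < w v) (A : Set V) : 0 ≤ setWeight w A := by
  unfold setWeight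
  refine Finset.sum_nonneg fun v _ => ?_
  by_cases hA : v ∈ A <;> simp [hA, (hw v).le]

theorem sw_singleton (w : V → ℝ) (a : V) : setWeight w {a} = w a := by
  simp [setWeight]

theorem sw_empty (w : V → ℝ) : setWeight w ∅ = 0 := by
  simp [setWeight]

theorem sw_union (w : V → ℝ) {A B : Set V} (h : ∀ x ∈ A, x ∉ B) :
    setWeight w (A ∪ B) = setWeight w A + setWeight w B := by
  unfold setWeight
  rw [← Finset.sum_add_distrib]
  refine Finset.sum_congr rfl fun v _ => ?_
  by_cases hA : v ∈ A
  · simp [hA, h v hA]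
  · simp [hA]

theorem sw_insert (w : V → ℝ) {A : Set V} {a : V} (h : a ∉ A) :
    setWeight w (insert a A) = w a + setWeight w A := by
  rw [← Set.singleton_union, sw_union, sw_singleton]
  rintro x rfl; exact h

/-- removing one vertex -/
theorem sw_split (w : V → ℝ) (A : Set V) (a : V) :
    setWeight w A = (if a ∈ A then w a else 0) + setWeight w (A \ {a}) := by
  by_cases h : a ∈ A
  · conv_lhs => rw [← Set.insert_diff_self_of_mem h]
    rw [sw_insert _ (by simp)]; simp [h]
  · simp [h]

theorem sw_pos {w : V → ℝ} (hw : ∀ v, 0 < w v) {A : Set V} (h : A.Nonempty) :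
    0 < setWeight w A := by
  obtain ⟨a, ha⟩ := h
  have := sw_mono hw (Set.singleton_subset_iff.2 ha)
  rw [sw_singleton] at this
  linarith [hw a]

theorem sw_le {w : V → ℝ} {A : Set V} {t : ℝ} (ht : 0 ≤ t) (h : ∀ a ∈ A, w a ≤ t) :
    setWeight w A ≤ Fintype.card V * t := by
  unfold setWeight
  have : ∑ v : V, (if v ∈ A then w v else 0) ≤ ∑ v : V, t := by
    refine Finset.sum_le_sum fun v _ => ?_
    by_cases hA : v ∈ A <;> simp [hA, ht, h]
  simpa using this

theorem safe_intro {G : SimpleGraph V} {w : V → ℝ} {S : Set V} (h1 : S.Nonempty)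
    (h2 : S ≠ Set.univ)
    (h : ∀ a ∈ S, ∀ b ∉ S, G.Adj a b →
      setWeight w {x | J G Sᶜ b x} ≤ setWeight w {x | J G S a x}) : IsSafeSet G w S := by
  refine ⟨h1, h2, fun C D hC hD hT => ?_⟩
  obtain ⟨a, ha, rfl⟩ := isComp_iff.1 hC
  obtain ⟨b, hb, rfl⟩ := isComp_iff.1 hD
  obtain ⟨a', ha', b', hb', hadj⟩ := hT
  have e1 : {x | J G S a x} = {x | J G S a' x} := by
    ext x; exact ⟨fun h => (J.symm ha').trans h, fun h => J.trans ha' h⟩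
  have e2 : {x | J G Sᶜ b x} = {x | J G Sᶜ b' x} := by
    ext x; exact ⟨fun h => (J.symm hb').trans h, fun h => J.trans hb' h⟩
  rw [e1, e2]
  exact h a' (J.mem ha' ha) b' (J.mem hb' hb) hadj

theorem conn_elim {G : SimpleGraph V} (hG : G.Connected) {w : V → ℝ} (hw : ∀ v, 0 < w v)
    {T : Set V} (hT : IsConnSafeSet G w T) :
    T.Nonempty ∧ Conn G T ∧
      ∀ K, Conn G K → (∀ x ∈ K, x ∉ T) → setWeight w K ≤ setWeight w T := by
  obtain ⟨⟨hne, hnu, hs⟩, hc⟩ := hT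
  have hc := conn_iff.1 hc
  refine ⟨hne, hc, fun K hK hd => ?_⟩
  obtain ⟨k, hk⟩ := hK.1
  obtain ⟨t, ht⟩ := hne
  set D : Set V := {x | J G Tᶜ k x} with hD
  have hkD : k ∈ D := J.refl k
  have hKD : K ⊆ D := fun x hx => (hK.2 k hk x hx).mono (fun y hy => hd y hy)
  have htD : t ∉ D := fun h => (J.mem h (hd k hk)) ht
  obtain ⟨u, hu, v, hv, huv⟩ := exists_edge hG hkD htD
  have hvT : v ∈ T := by
    by_contra hvT
    exact hv (J.trans hu (J.adj (J.mem hu (hd k hk)) hvT huv))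
  have h1 := hs {x | J G T t x} D (isComp_iff.2 ⟨t, ht, rfl⟩) (isComp_iff.2 ⟨k, hd k hk, rfl⟩)
    ⟨v, hc.2 t ht v hvT, u, hu, huv.symm⟩
  exact (sw_mono hw hKD).trans (h1.trans (sw_mono hw (fun x hx => J.mem hx ht)))

theorem bad {G : SimpleGraph V} {w : V → ℝ} (hw : ∀ v, 0 < w v) {S : Set V}
    (hS : IsSafeSet G w S) (h : ∀ T, IsConnSafeSet G w T → setWeight w S < setWeight w T) :
    ¬ InGcs G := by
  intro hg
  have e := hg w hw
  have hfin : (setWeight w '' {S | IsSafeSet G w S}).Finite := Set.toFinite _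
  have hne : (setWeight w '' {S | IsSafeSet G w S}).Nonempty := ⟨_, S, hS, rfl⟩
  have h1 : safeNumber G w ≤ setWeight w S := csInf_le hfin.bddBelow ⟨S, hS, rfl⟩
  have h2 : 0 < safeNumber G w := by
    obtain ⟨A, hA, hAe⟩ := hne.csInf_mem hfin
    have : safeNumber G w = setWeight w A := hAe.symm
    rw [this]; exact sw_pos hw hA.1
  by_cases hc : (setWeight w '' {S | IsConnSafeSet G w S}).Nonempty
  · obtain ⟨A, hA, hAe⟩ := hc.csInf_mem (Set.toFinite _)
    have : connSafeNumber G w = setWeight w A := hAe.symm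
    have := h A hA
    linarith
  · rw [Set.not_nonempty_iff_eq_empty] at hc
    have : connSafeNumber G w = 0 := by rw [connSafeNumber, hc, Real.sInf_empty]
    linarith

/-- rerouting -/
theorem reroute {G : SimpleGraph V} {S X : Set V} {x : V} (hS : Conn G S)
    (hX : Conn G X) (hXS : X ⊆ S \ {x}) (hN : ∀ y ∈ S, G.Adj x y → y ∈ X) :
    Conn G (S \ {x}) := by
  obtain ⟨r, hr⟩ := hX.1
  refine conn_of_root r (hXS hr) fun z hz => ?_
  have := (hS.2 r (hXS hr).1 z hz.1).closed (fun y => y ≠ x → J G (S \ {x}) r y)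
    (fun _ => J.refl _) ?_
  · exact this hz.2
  · intro u v hu hv huv hJ hvx
    by_cases hux : u = x
    · subst hux
      exact (hX.2 r hr v (hN v hv huv)).mono hXS
    · exact (hJ hux).trans (J.adj ⟨hu, hux⟩ ⟨hv, hvx⟩ huv)

theorem sw_ge1 {w : V → ℝ} (hw : ∀ v, 0 < w v) {A : Set V} {a : V} (ha : a ∈ A) :
    w a ≤ setWeight w A := by
  rw [← sw_singleton w a]; exact sw_mono hw (Set.singleton_subset_iff.2 ha)

theorem sw_ge2 {w : V → ℝ} (hw : ∀ v, 0 < w v) {A : Set V} {a b : V} (ha : a ∈ A) (hb : b ∈ A)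
    (hab : a ≠ b) : w a + w b ≤ setWeight w A := by
  rw [← sw_singleton w b, ← sw_insert w (by simpa using hab)]
  exact sw_mono hw (by rintro x (rfl | rfl) <;> assumption)

theorem sw_ge3 {w : V → ℝ} (hw : ∀ v, 0 < w v) {A : Set V} {a b c : V} (ha : a ∈ A) (hb : b ∈ A)
    (hc : c ∈ A) (hab : a ≠ b) (hac : a ≠ c) (hbc : b ≠ c) :
    w a + (w b + w c) ≤ setWeight w A := by
  rw [← sw_singleton w c, ← sw_insert w (by simpa using hbc), ← sw_insert w (by simp [hab, hac])]
  exact sw_mono hw (by rintro x (rfl | rfl | rfl) <;> assumption)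

theorem sw_pair (w : V → ℝ) {a b : V} (hab : a ≠ b) : setWeight w {a, b} = w a + w b := by
  rw [sw_insert _ (by simpa using hab), sw_singleton]

theorem sw_const {w : V → ℝ} {A : Set V} {t : ℝ} (h : ∀ a ∈ A, w a = t) :
    setWeight w A = A.ncard * t := by
  unfold setWeight
  have : ∀ v, (if v ∈ A then w v else 0) = if v ∈ A then t else 0 := by
    intro v; by_cases hv : v ∈ A <;> simp [hv, h]
  simp only [this]
  rw [← Finset.sum_filter, Finset.sum_const, nsmul_eq_mul, Set.ncard_eq_toFinset_card']
  congr 3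
  ext; simp

def TF (G : SimpleGraph V) : Prop := ∀ a b c, G.Adj a b → G.Adj a c → ¬ G.Adj b c

theorem lemmaK {G : SimpleGraph V} (hG : G.Connected) (hT : TF G) {c n1 n2 n3 : V}
    (h1 : G.Adj c n1) (h2 : G.Adj c n2) (h3 : G.Adj c n3) (h12 : n1 ≠ n2) (h13 : n1 ≠ n3)
    (h23 : n2 ≠ n3) (hW : Conn G {v | v ≠ c ∧ ¬ G.Adj c v})
    (hn : ∀ n, G.Adj c n → ∃ v, v ≠ c ∧ ¬ G.Adj c v ∧ G.Adj n v) : ¬ InGcs G := by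
  set W : Set V := {v | v ≠ c ∧ ¬ G.Adj c v} with hWd
  have hWpos : 0 < W.ncard := (Set.ncard_pos (Set.toFinite _)).2 hW.1
  have hm : (1:ℝ) ≤ W.ncard := by exact_mod_cast hWpos
  set m : ℝ := (W.ncard : ℝ) with hmd
  set e : ℝ := 1 / (2 * m) with he
  set s : ℝ := (1 + e) / m with hs
  have he0 : 0 < e := by positivity
  have he1 : e ≤ 1 / 2 := by
    rw [he, div_le_div_iff₀ (by positivity) (by norm_num)]; linarith
  have hse : e < s := by
    rw [hs, lt_div_iff₀ (by positivity)]
    have : e * m = 1 / 2 := by rw [he]; field_simp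
    linarith
  have hs0 : 0 < s := by linarith
  set w : V → ℝ := fun v => if v = c ∨ G.Adj c v then 1 else s with hwd
  have hw : ∀ v, 0 < w v := by
    intro v; simp only [hwd]; split_ifs <;> linarith
  have wc : w c = 1 := by simp [hwd]
  have wn : ∀ n, G.Adj c n → w n = 1 := fun n h => by simp [hwd, h]
  have wW : ∀ v ∈ W, w v = s := by
    rintro v ⟨hv1, hv2⟩; simp [hwd, hv1, hv2]
  have swW : setWeight w W = 1 + e := by
    rw [sw_const wW, hs, ← hmd]; field_simp
  have hcW : c ∉ W := fun h => h.1 rfl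
  have swS : setWeight w (insert c W) = 2 + e := by
    rw [sw_insert _ hcW, swW, wc]; ring
  have nW : ∀ n, G.Adj c n → n ∉ W := fun n h h' => h'.2 h
  have hcomp : ∀ b, b ∉ insert c W → G.Adj c b := by
    intro b hb
    by_contra h
    exact hb (by
      by_cases hbc : b = c
      · exact Or.inl hbc
      · exact Or.inr ⟨hbc, h⟩)
  refine bad hw (S := insert c W) (safe_intro ⟨c, Or.inl rfl⟩ ?_ ?_) ?_
  · intro h
    have : n1 ∈ insert c W := h ▸ Set.mem_univ _
    rcases this with h | h
    · exact h1.ne h.symm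
    · exact h.2 h1
  · intro a ha b hb hab
    have hD : {x | J G (insert c W)ᶜ b x} ⊆ {b} := by
      intro x hx
      refine J.closed hx (fun y => y = b) rfl ?_
      rintro u v hu hv huv rfl
      exact absurd huv (hT c _ _ (hcomp _ hu) (hcomp _ hv))
    have h5 := sw_mono hw hD
    rw [sw_singleton, wn _ (hcomp b hb)] at h5
    refine h5.trans ?_
    rcases ha with rfl | ha
    · rw [← wc]; exact sw_ge1 hw (J.refl _)
    · have : W ⊆ {x | J G (insert c W) a x} := fun x hx =>
        (hW.2 a ha x hx).mono (Set.subset_insert _ _)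
      have := sw_mono hw this
      linarith
  · intro T hTs
    obtain ⟨hTne, hTc, hK⟩ := conn_elim hG hw hTs
    rw [swS]
    by_contra hle
    push Not at hle
    by_cases hc : c ∈ T
    · have two : ∀ i j, G.Adj c i → G.Adj c j → i ∈ T → j ∈ T → i = j := by
        intro i j hi hj hiT hjT
        by_contra hij
        have := sw_ge3 hw hc hiT hjT hi.ne hj.ne hij
        rw [wc, wn _ hi, wn _ hj] at this
        linarith
      have hTW : ∀ y ∈ T, y ∉ W := by
        intro y hy hyW
        have : ∃ i, G.Adj c i ∧ i ∈ T := by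
          by_contra hno
          push Not at hno
          have : y = c := (hTc.2 c hc y hy).closed (fun z => z = c) rfl (by
            rintro u v hu hv huv rfl
            exact absurd hv (hno v huv))
          exact hyW.1 this
        obtain ⟨i, hi, hiT⟩ := this
        have := sw_ge3 hw hc hiT hy hi.ne hyW.1.symm (by rintro rfl; exact hyW.2 hi)
        rw [wc, wn _ hi, wW _ hyW] at this
        linarith
      have hle2 : setWeight w T ≤ 2 := by
        by_cases hex : ∃ i, G.Adj c i ∧ i ∈ T
        · obtain ⟨i, hi, hiT⟩ := hex
          have : T ⊆ {c, i} := by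
            intro y hy
            by_cases hyc : y = c
            · exact Or.inl hyc
            · right
              have hcy : G.Adj c y := by
                by_contra h; exact hTW y hy ⟨hyc, h⟩
              exact two _ _ hcy hi hy hiT
          have := sw_mono hw this
          rw [sw_pair w hi.ne, wc, wn _ hi] at this
          linarith
        · push Not at hex
          have : T ⊆ {c} := by
            intro y hy
            by_contra hyc
            have hcy : G.Adj c y := by
                by_contra h; exact hTW y hy ⟨hyc, h⟩
            exact hex _ hcy hy
          have := sw_mono hw this
          rw [sw_singleton, wc] at this
          linarith
      have : ∃ j, G.Adj c j ∧ j ∉ T := by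
        by_contra hno
        push Not at hno
        exact h12 (two _ _ h1 h2 (hno _ h1) (hno _ h2))
      obtain ⟨j, hj, hjT⟩ := this
      obtain ⟨v, hv1, hv2, hv3⟩ := hn j hj
      have := hK (insert j W) (conn_insert hW (a := v) ⟨hv1, hv2⟩ hv3) (by
        rintro x (rfl | hx)
        · exact hjT
        · exact fun h => hTW x h hx)
      rw [sw_insert _ (nW j hj), swW, wn _ hj] at this
      linarith
    · have hK1 := hK (insert c {n | G.Adj c n ∧ n ∉ T}) (conn_star fun a ha => ha.1) (by
        rintro x (rfl | hx)
        · exact hc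
        · exact hx.2)
      have two : ∀ i j, G.Adj c i → G.Adj c j → i ≠ j → i ∉ T → j ∈ T := by
        intro i j hi hj hij hiT
        by_contra hjT
        have := sw_ge3 hw (A := insert c {n | G.Adj c n ∧ n ∉ T}) (a := c) (b := i) (c := j)
          (Or.inl rfl) (Or.inr ⟨hi, hiT⟩) (Or.inr ⟨hj, hjT⟩) hi.ne hj.ne hij
        rw [wc, wn _ hi, wn _ hj] at this
        linarith
      have : ∃ i j, G.Adj c i ∧ G.Adj c j ∧ i ≠ j ∧ i ∈ T ∧ j ∈ T := by
        by_cases hi1 : n1 ∈ T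
        · by_cases hi2 : n2 ∈ T
          · exact ⟨n1, n2, h1, h2, h12, hi1, hi2⟩
          · exact ⟨n1, n3, h1, h3, h13, hi1, two _ _ h2 h3 h23 hi2⟩
        · exact ⟨n2, n3, h2, h3, h23, two _ _ h1 h2 h12 hi1, two _ _ h1 h3 h13 hi1⟩
      obtain ⟨i, j, hi, hj, hij, hiT, hjT⟩ := this
      have : ∃ y ∈ T, y ≠ i ∧ y ≠ j := by
        by_contra hno
        push Not at hno
        have : j = i := (hTc.2 i hiT j hjT).closed (fun z => z = i) rfl (by
            rintro u v hu hv huv rfl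
            by_contra hvi
            exact hT c _ _ hi hj (hno v hv hvi ▸ huv))
        exact hij this.symm
      obtain ⟨y, hy, hyi, hyj⟩ := this
      have h6 := sw_ge3 hw hiT hjT hy hij hyi.symm hyj.symm
      have h7 : e < w y := by
        simp only [hwd]
        split_ifs <;> linarith
      rw [wn _ hi, wn _ hj] at h6
      linarith

theorem sw_decomp4 (w : V → ℝ) {a b c d : V} (hab : a ≠ b) (hac : a ≠ c) (had : a ≠ d)
    (hbc : b ≠ c) (hbd : b ≠ d) (hcd : c ≠ d) (T : Set V) :
    setWeight w T = (if a ∈ T then w a else 0) + (if b ∈ T then w b else 0) +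
      (if c ∈ T then w c else 0) + (if d ∈ T then w d else 0) +
      setWeight w (T \ {a, b, c, d}) := by
  rw [sw_split w T a, sw_split w (T \ {a}) b, sw_split w ((T \ {a}) \ {b}) c,
    sw_split w (((T \ {a}) \ {b}) \ {c}) d]
  have hset : (((T \ {a}) \ {b}) \ {c}) \ {d} = T \ {a, b, c, d} := by
    ext x; simp only [Set.mem_diff, Set.mem_insert_iff, Set.mem_singleton_iff]; tauto
  rw [hset]
  simp only [Set.mem_diff, Set.mem_singleton_iff, hab.symm, hac.symm, had.symm, hbc.symm,
    hbd.symm, hcd.symm, not_false_eq_true, and_true]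
  ring

theorem lemmaQ {G : SimpleGraph V} (hG : G.Connected) (hT : TF G) {e e1 e2 x x' : V}
    (h1 : G.Adj e e1) (h2 : G.Adj e e2) (h12 : e1 ≠ e2) (hN : ∀ v, G.Adj e v → v = e1 ∨ v = e2)
    (hxe : x ≠ e) (hex : ¬ G.Adj e x) (hx1 : ¬ G.Adj x e1) (hx2 : ¬ G.Adj x e2)
    (hxx : G.Adj x x') (hC : Conn G {v | v ≠ e ∧ ¬ G.Adj e v ∧ v ≠ x}) : ¬ InGcs G := by
  set C : Set V := {v | v ≠ e ∧ ¬ G.Adj e v ∧ v ≠ x} with hCd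
  have hx'e : x' ≠ e := by rintro rfl; exact hex hxx.symm
  have hx'1 : x' ≠ e1 := by rintro rfl; exact hx1 hxx
  have hx'2 : x' ≠ e2 := by rintro rfl; exact hx2 hxx
  have hxe1 : x ≠ e1 := by rintro rfl; exact hex h1
  have hxe2 : x ≠ e2 := by rintro rfl; exact hex h2
  have hee1 := h1.ne
  have hee2 := h2.ne
  have hx'C : x' ∈ C := ⟨hx'e, fun h => (hN _ h).elim hx'1 hx'2, hxx.ne.symm⟩
  have hcard : (0:ℝ) < Fintype.card V := by
    have : 0 < Fintype.card V := Fintype.card_pos_iff.2 ⟨e⟩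
    exact_mod_cast this
  set δ : ℝ := 0.04 / Fintype.card V with hδ
  have hδ0 : 0 < δ := by positivity
  have hδc : Fintype.card V * δ = 0.04 := by rw [hδ]; field_simp
  set w : V → ℝ := fun v => if v = e then 1.3 else if v = e1 ∨ v = e2 then 1 else
    if v = x ∨ v = x' then 1.2 else δ with hwd
  have hw : ∀ v, 0 < w v := by
    intro v; simp only [hwd]; split_ifs <;> first | exact hδ0 | norm_num
  have we : w e = 1.3 := by simp [hwd]
  have we1 : w e1 = 1 := by simp [hwd, hee1.symm]
  have we2 : w e2 = 1 := by simp [hwd, hee2.symm]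
  have wx : w x = 1.2 := by simp [hwd, hxe, hxe1, hxe2]
  have wx' : w x' = 1.2 := by simp [hwd, hx'e, hx'1, hx'2]
  have dec : ∀ T : Set V, ∃ r : ℝ, 0 ≤ r ∧ r ≤ 0.04 ∧ setWeight w T =
      (if e ∈ T then 1.3 else 0) + ((if e1 ∈ T then 1 else 0) + (if e2 ∈ T then 1 else 0) +
      (if x ∈ T then 1.2 else 0) + (if x' ∈ T then 1.2 else 0) + r) := by
    intro T
    refine ⟨setWeight w ((T \ {e}) \ {e1, e2, x, x'}), sw_nonneg hw _, ?_, ?_⟩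
    · rw [← hδc]
      apply sw_le hδ0.le
      rintro a ⟨⟨_, ha⟩, ha2⟩
      simp only [Set.mem_insert_iff, Set.mem_singleton_iff, not_or] at ha ha2
      simp [hwd, ha, ha2]
    · rw [sw_split w T e, sw_decomp4 w h12 hxe1.symm hx'1.symm hxe2.symm hx'2.symm hxx.ne,
        we, we1, we2, wx, wx']
      simp [hee1.symm, hee2.symm, hxe, hx'e]
  have hcomp : ∀ b, b ∉ insert e C → b = e1 ∨ b = e2 ∨ b = x := by
    intro b hb
    by_contra h
    push Not at h
    exact hb (by
      by_cases hbc : b = e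
      · exact Or.inl hbc
      · exact Or.inr ⟨hbc, fun h' => (hN b h').elim h.1 h.2.1, h.2.2⟩)
  have hn12 : ¬ G.Adj e1 e2 := hT e _ _ h1 h2
  have swS : setWeight w (insert e C) ≤ 2.54 := by
    obtain ⟨r, _, hr, heq⟩ := dec (insert e C)
    have c1 : e1 ∉ insert e C := by
      rintro (h | h)
      · exact hee1 h.symm
      · exact h.2.1 h1
    have c2 : e2 ∉ insert e C := by
      rintro (h | h)
      · exact hee2 h.symm
      · exact h.2.1 h2
    have c3 : x ∉ insert e C := by
      rintro (h | h)
      · exact hxe h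
      · exact h.2.2 rfl
    rw [heq]
    simp only [c1, c2, c3, if_false]
    split_ifs <;> linarith
  refine bad hw (S := insert e C) (safe_intro ⟨e, Or.inl rfl⟩ ?_ ?_) ?_
  · intro h
    have : e1 ∈ insert e C := h ▸ Set.mem_univ _
    rcases this with h | h
    · exact hee1 h.symm
    · exact h.2.1 h1
  · intro a ha b hb hab
    have hD : {z | J G (insert e C)ᶜ b z} ⊆ {b} := by
      intro z hz
      refine J.closed hz (fun y => y = b) rfl ?_
      rintro u v hu hv huv rfl
      exfalso
      rcases hcomp _ hu with rfl | rfl | rfl <;> rcases hcomp _ hv with rfl | rfl | rfl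
      · exact huv.ne rfl
      · exact hn12 huv
      · exact hx1 huv.symm
      · exact hn12 huv.symm
      · exact huv.ne rfl
      · exact hx2 huv.symm
      · exact hx1 huv
      · exact hx2 huv
      · exact huv.ne rfl
    have h5 := sw_mono hw hD
    rw [sw_singleton] at h5
    refine h5.trans ?_
    rcases ha with rfl | ha
    · have : w a ≤ setWeight w {y | J G (insert a C) a y} := sw_ge1 hw (J.refl _)
      rcases hN b hab with rfl | rfl <;> linarith
    · have : w x' ≤ setWeight w {y | J G (insert e C) a y} :=
        sw_ge1 hw ((hC.2 a ha x' hx'C).mono (Set.subset_insert _ _))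
      rcases hcomp b hb with rfl | rfl | rfl <;> linarith
  · intro T hTs
    obtain ⟨hTne, hTc, hK⟩ := conn_elim hG hw hTs
    by_contra hle
    push Not at hle
    replace hle := hle.trans swS
    have cpair : ∀ a b, G.Adj a b → Conn G {a, b} := fun a b h => conn_star (by
      rintro y rfl; exact h)
    have k1 : x ∉ T → x' ∉ T → 2.4 ≤ setWeight w T := by
      intro ha hb
      have := hK _ (cpair _ _ hxx) (by rintro y (rfl | rfl) <;> assumption)
      rw [sw_pair w hxx.ne] at this; linarith
    have k2 : e ∉ T → e1 ∉ T → 2.3 ≤ setWeight w T := by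
      intro ha hb
      have := hK _ (cpair _ _ h1) (by rintro y (rfl | rfl) <;> assumption)
      rw [sw_pair w h1.ne] at this; linarith
    have k3 : e ∉ T → e2 ∉ T → 2.3 ≤ setWeight w T := by
      intro ha hb
      have := hK _ (cpair _ _ h2) (by rintro y (rfl | rfl) <;> assumption)
      rw [sw_pair w h2.ne] at this; linarith
    have k4 : e ∉ T → e1 ∉ T → e2 ∉ T → 3.3 ≤ setWeight w T := by
      intro ha hb hc
      have := hK {e, e1, e2} (conn_star (by rintro y (rfl | rfl) <;> assumption))
        (by rintro y (rfl | rfl | rfl) <;> assumption)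
      rw [sw_insert _ (by simp [hee1, hee2]), sw_pair w h12] at this; linarith
    have k5 : e ∈ T → e1 ∉ T → e2 ∉ T → x ∉ T ∧ x' ∉ T := by
      intro ha hb hc
      have : ∀ y ∈ T, y = e := fun y hy => (hTc.2 e ha y hy).closed (fun z => z = e) rfl (by
        rintro u v hu hv huv rfl
        rcases hN v huv with rfl | rfl <;> contradiction)
      exact ⟨fun h => hxe (this _ h), fun h => hx'e (this _ h)⟩
    obtain ⟨r, hr0, hr, heq⟩ := dec T
    by_cases be : e ∈ T <;> by_cases b1 : e1 ∈ T <;> by_cases b2 : e2 ∈ T <;>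
      by_cases bx : x ∈ T <;> by_cases bx' : x' ∈ T <;>
      simp only [be, b1, b2, bx, bx', if_true, if_false, not_true_eq_false, not_false_eq_true,
        forall_true_left, false_and, and_false, and_true, false_imp_iff] at heq k1 k2 k3 k4 k5 <;>
      linarith

theorem lemmaP {G : SimpleGraph V} (hG : G.Connected) {X' Y' : Set V} {x x' d e : V}
    (hxX : x ∉ X') (heY : e ∉ Y') (hX : Conn G X') (hY : Conn G Y')
    (hNx : ∀ v, G.Adj x v → v ∈ X') (hNe : ∀ v, G.Adj e v → v ∈ Y')
    (hxx : G.Adj x x') (hed : G.Adj e d)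
    (hdis : ∀ a ∈ insert x X', ∀ b ∈ insert e Y', a ≠ b ∧ ¬ G.Adj a b) : ¬ InGcs G := by
  have hx'X : x' ∈ X' := hNx _ hxx
  have hdY : d ∈ Y' := hNe _ hed
  have hxd : x ≠ d := (hdis x (Or.inl rfl) d (Or.inr hdY)).1
  have hxe : x ≠ e := (hdis x (Or.inl rfl) e (Or.inl rfl)).1
  have hx'd : x' ≠ d := (hdis x' (Or.inr hx'X) d (Or.inr hdY)).1
  have hx'e : x' ≠ e := (hdis x' (Or.inr hx'X) e (Or.inl rfl)).1
  set X : Set V := insert x X' with hXd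
  set Y : Set V := insert e Y' with hYd
  have hcard : (1:ℝ) ≤ Fintype.card V := by
    have : 0 < Fintype.card V := Fintype.card_pos_iff.2 ⟨e⟩
    exact_mod_cast this
  set N : ℝ := (Fintype.card V : ℝ) with hN
  have hN0 : 0 < N := by linarith
  set δ : ℝ := 0.1 / N with hδ
  set η : ℝ := 0.05 / N / N with hη
  have hδ0 : 0 < δ := by positivity
  have hη0 : 0 < η := by positivity
  have hNδ : N * δ = 0.1 := by rw [hδ]; field_simp
  have hNη : N * η = δ / 2 := by rw [hη, hδ]; field_simp; norm_num
  have hηδ : η ≤ δ := by nlinarith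
  set w : V → ℝ := fun v => if v = x ∨ v = x' ∨ v = d ∨ v = e then 1 else
    if v ∈ X ∪ Y then η else δ with hwd
  have hw : ∀ v, 0 < w v := by
    intro v; simp only [hwd]; split_ifs <;> first | assumption | norm_num
  have wx : w x = 1 := by simp [hwd]
  have wx' : w x' = 1 := by simp [hwd]
  have wd : w d = 1 := by simp [hwd]
  have we : w e = 1 := by simp [hwd]
  have wQ : ∀ q, q ∉ X → q ∉ Y → w q = δ := by
    intro q h1 h2
    have a1 : q ≠ x := by rintro rfl; exact h1 (Or.inl rfl)
    have a2 : q ≠ x' := by rintro rfl; exact h1 (Or.inr hx'X)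
    have a3 : q ≠ d := by rintro rfl; exact h2 (Or.inr hdY)
    have a4 : q ≠ e := by rintro rfl; exact h2 (Or.inl rfl)
    simp [hwd, h1, h2, a1, a2, a3, a4]
  have dec : ∀ T : Set V, setWeight w T =
      (if x ∈ T then 1 else 0) + (if x' ∈ T then 1 else 0) +
      (if d ∈ T then 1 else 0) + (if e ∈ T then 1 else 0) + setWeight w (T \ {x, x', d, e}) := by
    intro T
    rw [sw_decomp4 w hxx.ne hxd hxe hx'd hx'e hed.ne.symm T, wx, wx', wd, we]
  have hSx : x ∉ X' ∪ Y' := by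
    rintro (h | h)
    · exact hxX h
    · exact (hdis x (Or.inl rfl) x (Or.inr h)).1 rfl
  have hSe : e ∉ X' ∪ Y' := by
    rintro (h | h)
    · exact (hdis e (Or.inr h) e (Or.inl rfl)).1 rfl
    · exact heY h
  have swS : setWeight w (X' ∪ Y') ≤ 2 + δ / 2 := by
    rw [dec]
    have : setWeight w ((X' ∪ Y') \ {x, x', d, e}) ≤ N * η := by
      apply sw_le hη0.le
      rintro a ⟨ha, ha2⟩
      have : a ∈ X ∪ Y := ha.elim (fun h => Or.inl (Or.inr h)) (fun h => Or.inr (Or.inr h))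
      simp only [Set.mem_insert_iff, Set.mem_singleton_iff, not_or] at ha2
      simp only [hwd, ha2, this, or_self, if_true, if_false]
      exact le_rfl
    simp only [hSx, hSe, if_false]
    split_ifs <;> linarith
  have hXc : Conn G X := conn_insert hX hx'X hxx
  have hYc : Conn G Y := conn_insert hY hdY hed
  refine bad hw (S := X' ∪ Y') (safe_intro ⟨x', Or.inl hx'X⟩ ?_ ?_) ?_
  · intro h
    exact hSx (h ▸ Set.mem_univ _)
  · intro a ha b hb hab
    have hCa : 1 ≤ setWeight w {y | J G (X' ∪ Y') a y} := by
      rcases ha with ha | ha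
      · rw [← wx']
        exact sw_ge1 hw ((hX.2 a ha x' hx'X).mono Set.subset_union_left)
      · rw [← wd]
        exact sw_ge1 hw ((hY.2 a ha d hdY).mono Set.subset_union_right)
    refine le_trans ?_ hCa
    by_cases hbx : b = x
    · subst hbx
      have hD : {z | J G (X' ∪ Y')ᶜ b z} ⊆ {b} := by
        intro z hz
        refine J.closed hz (fun y => y = b) rfl ?_
        rintro u v hu hv huv rfl
        exact absurd (Or.inl (hNx _ huv)) hv
      have := sw_mono hw hD
      rw [sw_singleton] at this; linarith
    by_cases hbe : b = e
    · subst hbe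
      have hD : {z | J G (X' ∪ Y')ᶜ b z} ⊆ {b} := by
        intro z hz
        refine J.closed hz (fun y => y = b) rfl ?_
        rintro u v hu hv huv rfl
        exact absurd (Or.inr (hNe _ huv)) hv
      have := sw_mono hw hD
      rw [sw_singleton] at this; linarith
    have hD : ∀ z, J G (X' ∪ Y')ᶜ b z → z ∉ X ∧ z ∉ Y := by
      intro z hz
      have hzS : z ∉ X' ∪ Y' := J.mem hz hb
      have : z ≠ x ∧ z ≠ e := by
        refine J.closed hz (fun y => y ≠ x ∧ y ≠ e) ⟨hbx, hbe⟩ ?_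
        rintro u v hu hv huv ⟨h1, h2⟩
        constructor
        · rintro rfl
          exact hu (Or.inl (hNx _ huv.symm))
        · rintro rfl
          exact hu (Or.inr (hNe _ huv.symm))
      exact ⟨fun h => h.elim this.1 (fun h => hzS (Or.inl h)),
        fun h => h.elim this.2 (fun h => hzS (Or.inr h))⟩
    have : setWeight w {z | J G (X' ∪ Y')ᶜ b z} ≤ N * δ :=
      sw_le hδ0.le (fun a ha => (wQ a (hD a ha).1 (hD a ha).2).le)
    linarith
  · intro T hTs
    obtain ⟨hTne, hTc, hK⟩ := conn_elim hG hw hTs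
    by_contra hle
    push Not at hle
    replace hle := hle.trans swS
    have side : ∀ (Z : Set V) (p q v u : V), Conn G Z → (∀ t ∈ Z, t ∉ T) → p ∈ Z → q ∈ Z → p ≠ q →
        w p = 1 → w q = 1 → v ∉ X → v ∉ Y → v ∉ Z → v ∉ T → u ∈ Z → G.Adj u v → False := by
      intro Z p q v u hZ hZT hp hq hpq wp wq hv1 hv2 hv3 hv4 hu huv
      have h1 := hK (insert v Z) (conn_insert hZ hu huv.symm) (by
        rintro y (rfl | hy)
        · exact hv4
        · exact hZT y hy)
      have h2 := sw_ge2 hw hp hq hpq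
      rw [sw_insert _ hv3, wQ v hv1 hv2] at h1
      linarith
    have hxY : x ∉ Y := fun h => (hdis x (Or.inl rfl) x h).1 rfl
    have heX : e ∉ X := fun h => (hdis e h e (Or.inl rfl)).1 rfl
    by_cases hQ : ∃ q ∈ T, q ∉ X ∧ q ∉ Y
    · obtain ⟨q, hq, hqX, hqY⟩ := hQ
      have n1 : q ≠ x := by rintro rfl; exact hqX (Or.inl rfl)
      have n2 : q ≠ x' := by rintro rfl; exact hqX (Or.inr hx'X)
      have n3 : q ≠ d := by rintro rfl; exact hqY (Or.inr hdY)
      have n4 : q ≠ e := by rintro rfl; exact hqY (Or.inl rfl)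
      have hr1 : δ ≤ setWeight w (T \ {x, x', d, e}) := by
        rw [← wQ q hqX hqY]
        exact sw_ge1 hw ⟨hq, by simp [n1, n2, n3, n4]⟩
      have hr2 : setWeight w (T \ {x, x', d, e}) ≤ N * δ := by
        apply sw_le hδ0.le
        rintro a ⟨ha, ha2⟩
        simp only [Set.mem_insert_iff, Set.mem_singleton_iff, not_or] at ha2
        simp only [hwd, ha2, or_self, if_false]
        split_ifs <;> linarith
      have cpair : ∀ a b, G.Adj a b → Conn G {a, b} := fun a b h => conn_star (by
        rintro y rfl; exact h)
      have k1 : x ∉ T → x' ∉ T → 2 ≤ setWeight w T := by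
        intro ha hb
        have := hK _ (cpair _ _ hxx) (by rintro y (rfl | rfl) <;> assumption)
        rw [sw_pair w hxx.ne] at this; linarith
      have k2 : e ∉ T → d ∉ T → 2 ≤ setWeight w T := by
        intro ha hb
        have := hK _ (cpair _ _ hed) (by rintro y (rfl | rfl) <;> assumption)
        rw [sw_pair w hed.ne] at this; linarith
      have heq := dec T
      by_cases be : x ∈ T <;> by_cases b1 : x' ∈ T <;> by_cases b2 : d ∈ T <;>
        by_cases bx : e ∈ T <;>
        simp only [be, b1, b2, bx, if_true, if_false, not_true_eq_false, not_false_eq_true,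
          forall_true_left, false_imp_iff] at heq k1 k2 <;>
        linarith
    · push Not at hQ
      obtain ⟨t, ht⟩ := hTne
      by_cases htX : t ∈ X
      · have hTX : ∀ y ∈ T, y ∈ X := fun y hy => (hTc.2 t ht y hy).closed (fun z => z ∈ X) htX (by
          intro u v hu hv huv huX
          by_contra hvX
          exact (hdis u huX v (hQ v hv hvX)).2 huv)
        have hdj : ∀ y ∈ Y, y ∉ X := fun y hy hyX => (hdis y hyX y hy).1 rfl
        obtain ⟨u, hu, v, hv, huv⟩ := exists_edge hG (T := Y) (a := e) (Or.inl rfl) hxY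
        have hvX : v ∉ X := fun h => (hdis v h u hu).2 huv.symm
        exact side Y d e v u hYc (fun y hy h => hdj y hy (hTX y h)) (Or.inr hdY) (Or.inl rfl)
          hed.ne.symm wd we hvX hv hv (fun h => hvX (hTX v h)) hu huv
      · have hTY : ∀ y ∈ T, y ∈ Y := fun y hy =>
          (hTc.2 t ht y hy).closed (fun z => z ∈ Y) (hQ t ht htX) (by
          intro u v hu hv huv huY
          by_contra hvY
          have hvX : v ∈ X := by
            by_contra h; exact hvY (hQ v hv h)
          exact (hdis v hvX u huY).2 huv.symm)
        have hdj : ∀ y ∈ X, y ∉ Y := fun y hy hyY => (hdis y hy y hyY).1 rfl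
        obtain ⟨u, hu, v, hv, huv⟩ := exists_edge hG (T := X) (a := x) (Or.inl rfl) heX
        have hvY : v ∉ Y := fun h => (hdis u hu v h).2 huv
        exact side X x x' v u hXc (fun y hy h => hdj y hy (hTY y h)) (Or.inl rfl) (Or.inr hx'X)
          hxx.ne wx wx' hv hvY hv (fun h => hvY (hTY v h)) hu huv

/-- Complement of the closed neighbourhood. -/
def NB (G : SimpleGraph V) (c : V) : Set V := {v | v ≠ c ∧ ¬ G.Adj c v}

def ZT (G : SimpleGraph V) (c : V) : Prop :=
  ∃ c1 c2, c1 ≠ c2 ∧ G.Adj c c1 ∧ G.Adj c c2 ∧ (∀ v, G.Adj c v → v = c1 ∨ v = c2) ∧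
    Conn G (NB G c)

def PT (G : SimpleGraph V) (c : V) : Prop :=
  ∃ (x : V) (X : Set V) (x' : V), x ∉ X ∧ Conn G X ∧ (∀ v, G.Adj x v → v ∈ X) ∧ G.Adj x x' ∧
    ∀ v ∈ insert x X, G.Adj c v ∨ ∀ n, G.Adj v n → G.Adj c n

def Far (G : SimpleGraph V) (v z : V) : Prop :=
  v ≠ z ∧ ¬ G.Adj v z ∧ ∀ n, G.Adj v n → ¬ G.Adj z n

theorem dist2 {G : SimpleGraph V} {a b c : V} (h1 : G.Adj a b) (h2 : G.Adj b c) :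
    G.dist a c ≤ 2 := dist_le (Walk.cons h1 (Walk.cons h2 Walk.nil))

theorem dist3 {G : SimpleGraph V} {a b c d : V} (h1 : G.Adj a b) (h2 : G.Adj b c)
    (h3 : G.Adj c d) : G.dist a d ≤ 3 :=
  dist_le (Walk.cons h1 (Walk.cons h2 (Walk.cons h3 Walk.nil)))

theorem far_of_dist {G : SimpleGraph V} {v z : V} (h : 3 ≤ G.dist v z) : Far G v z := by
  refine ⟨?_, ?_, ?_⟩
  · rintro rfl; simp at h
  · intro ha; rw [dist_eq_one_iff_adj.2 ha] at h; omega
  · intro n h1 h2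
    have := dist2 h1 h2.symm
    omega

theorem dist_step {G : SimpleGraph V} (hG : G.Connected) {a b c : V} (h : G.Adj a b) :
    G.dist a c ≤ G.dist b c + 1 := by
  have := hG.dist_triangle (u := a) (v := b) (w := c)
  rw [dist_eq_one_iff_adj.2 h] at this
  omega

theorem exists_nbr {G : SimpleGraph V} (hG : G.Connected) {a b : V} (h : a ≠ b) :
    ∃ n, G.Adj a n := by
  obtain ⟨u, hu, v, hv, huv⟩ := exists_edge hG (T := {a}) (a := a) (b := b) rfl (fun hh => h hh.symm)
  have : u = a := hu
  exact ⟨v, this ▸ huv⟩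

theorem lemmaDeg {G : SimpleGraph V} (hG : G.Connected) (hT : TF G) (hg : InGcs G) {c : V}
    (hW : Conn G (NB G c)) (hn : ∀ n, G.Adj c n → ∃ v ∈ NB G c, G.Adj n v) :
    (∃ a, G.Adj c a ∧ ∀ v, G.Adj c v → v = a) ∨ ZT G c := by
  obtain ⟨y, hy⟩ := hW.1
  obtain ⟨a, ha⟩ := exists_nbr hG hy.1.symm
  by_cases h1 : ∀ v, G.Adj c v → v = a
  · exact Or.inl ⟨a, ha, h1⟩
  push Not at h1
  obtain ⟨b, hb, hba⟩ := h1
  right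
  by_cases h2 : ∀ v, G.Adj c v → v = a ∨ v = b
  · exact ⟨a, b, hba.symm, ha, hb, h2, hW⟩
  push Not at h2
  obtain ⟨d, hd, hda, hdb⟩ := h2
  exact absurd hg (lemmaK hG hT ha hb hd hba.symm hda.symm hdb.symm hW (fun n h => by
    obtain ⟨v, hv, hv'⟩ := hn n h
    exact ⟨v, hv.1, hv.2, hv'⟩))

theorem lemmaE {G : SimpleGraph V} (hG : G.Connected) (hT : TF G) (hg : InGcs G) {c0 y : V}
    (h0 : 4 ≤ G.dist c0 y) : ∃ c, 4 ≤ G.dist c y ∧ (PT G c ∨ ZT G c) := by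
  obtain ⟨c, hc, hmax⟩ := Finset.exists_max_image (Finset.univ.filter fun c => 4 ≤ G.dist c y)
    (fun c => {v | J G (NB G c) y v}.ncard) ⟨c0, by simpa using h0⟩
  simp only [Finset.mem_filter, Finset.mem_univ, true_and] at hc hmax
  refine ⟨c, hc, ?_⟩
  have hyc : y ≠ c := by rintro rfl; simp at hc
  have hyN : y ∈ NB G c := ⟨hyc, fun h => by
    rw [dist_eq_one_iff_adj.2 h] at hc; omega⟩
  have hWN : ∀ v, J G (NB G c) y v → v ∈ NB G c := fun v h => J.mem h hyN
  by_cases hA : ∃ u ∈ NB G c, ¬ J G (NB G c) y u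
  · left
    have hi : ∀ u, u ∈ NB G c → ¬ J G (NB G c) y u → 4 ≤ G.dist u y := by
      intro u hu hJ
      obtain ⟨p, hp⟩ := hG.exists_walk_length_eq_dist u y
      rw [← hp]
      clear hp hmax hA
      induction p with
      | nil => exact absurd (J.refl _) hJ
      | @cons a b d h p ih =>
        rw [Walk.length_cons]
        by_cases hb : b ∈ NB G c
        · have := ih h0 hc hyc hyN hWN hb (fun hJ' => hJ (hJ'.trans (J.adj hb hu h.symm)))
          omega
        · have h1 := dist_le p
          have h2 : G.dist c d ≤ G.dist b d + 1 := by
            by_cases hbc : b = c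
            · subst hbc; omega
            · apply dist_step hG
              by_contra hcb
              exact hb ⟨hbc, hcb⟩
          omega
    have hii : ∀ u, u ∈ NB G c → ¬ J G (NB G c) y u → ∀ n v, G.Adj c n → G.Adj n v →
        J G (NB G c) y v → G.Adj u n := by
      intro u hu hJ n v hcn hnv hv
      by_contra hun
      have hsub : ∀ z, J G (NB G c) y z → z ∈ NB G u := by
        intro z hz
        refine ⟨by rintro rfl; exact hJ hz, fun h => hJ (hz.trans (J.adj (hWN _ hz) hu h.symm))⟩
      have hnu : n ∈ NB G u := ⟨by rintro rfl; exact hu.2 hcn, hun⟩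
      have hlt : {v | J G (NB G c) y v}.ncard < {v | J G (NB G u) y v}.ncard := by
        apply Set.ncard_lt_ncard _ (Set.toFinite _)
        refine ⟨fun z hz => J.within hz hsub, fun hh => ?_⟩
        have : n ∈ {v | J G (NB G u) y v} :=
          (J.within hv hsub).trans (J.adj (hsub v hv) hnu hnv.symm)
        exact (hWN _ (hh this)).2 hcn
      have := hmax u (hi u hu hJ)
      omega
    obtain ⟨v, hv, n, hn, hvn⟩ := exists_edge hG (T := {v | J G (NB G c) y v}) (a := y) (b := c)
      (J.refl _) (fun h => (hWN _ h).1 rfl)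
    have hnN : n ∉ NB G c := fun h => hn (J.trans hv (J.adj (hWN _ hv) h hvn))
    have hnc : n ≠ c := by rintro rfl; exact (hWN _ hv).2 hvn.symm
    have hcn : G.Adj c n := by
      by_contra h; exact hnN ⟨hnc, h⟩
    obtain ⟨u, hu, hJ⟩ := hA
    have hun := hii u hu hJ n v hcn hvn.symm hv
    have hiii : ∀ z, G.Adj u z → G.Adj c z := by
      intro z huz
      by_contra hcz
      have hzc : z ≠ c := by rintro rfl; exact hu.2 huz.symm
      have hzN : z ∈ NB G c := ⟨hzc, hcz⟩
      have hzn := hii z hzN (fun h => hJ (h.trans (J.adj hzN hu huz.symm))) n v hcn hvn.symm hv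
      exact hT u z n huz hun hzn
    refine ⟨u, insert c {z | G.Adj u z}, n, ?_, conn_star hiii, fun z hz => Or.inr hz, hun, ?_⟩
    · rintro (h | h)
      · exact hu.1 h
      · exact G.loopless.irrefl _ h
    · rintro z (rfl | rfl | hz)
      · exact Or.inr hiii
      · exact Or.inr fun _ h => h
      · exact Or.inl (hiii z hz)
  · push Not at hA
    have hW : Conn G (NB G c) := conn_of_root y hyN hA
    by_cases hB : ∀ n, G.Adj c n → ∃ v ∈ NB G c, G.Adj n v
    · rcases lemmaDeg hG hT hg hW hB with ⟨a, ha, ha'⟩ | h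
      · left
        refine ⟨c, {a}, a, ha.ne, conn_singleton G a, ha', ha, ?_⟩
        rintro z (rfl | rfl)
        · exact Or.inr fun _ h => h
        · exact Or.inl ha
      · exact Or.inr h
    · push Not at hB
      obtain ⟨b, hb, hb'⟩ := hB
      left
      refine ⟨b, {c}, c, hb.ne.symm, conn_singleton G c, ?_, hb.symm, ?_⟩
      · intro v hv
        by_contra hvc
        by_cases h : G.Adj c v
        · exact hT c b v hb h hv
        · exact hb' v ⟨hvc, h⟩ hv
      · rintro z (rfl | rfl)
        · exact Or.inl hb
        · exact Or.inr fun _ h => h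

theorem cut {G : SimpleGraph V} (hG : G.Connected) (hT : TF G) (hg : InGcs G) {z v : V}
    (hz : ZT G z) (hv : Far G v z) : ¬ Conn G (NB G z \ {v}) := by
  intro hc
  obtain ⟨z1, z2, h12, h1, h2, hN, _⟩ := hz
  obtain ⟨v', hv'⟩ := exists_nbr hG hv.1
  refine lemmaQ hG hT h1 h2 h12 hN hv.1 (fun h => hv.2.1 h.symm) (fun h => hv.2.2 _ h h1)
    (fun h => hv.2.2 _ h h2) hv' ?_ hg
  convert hc using 1
  ext a
  simp [NB, and_assoc]

theorem noncut {G : SimpleGraph V} (hG : G.Connected) (hT : TF G) (hg : InGcs G) {z v k : V}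
    (hz : ZT G z) {R : Set V} (hv : v ∈ NB G z) (hvR : v ∈ R) (hR : ∀ r ∈ R, r = v ∨ G.Adj v r)
    (hk : k ∈ NB G z \ R) : ∃ f n, J G (NB G z \ R) k f ∧ G.Adj f n ∧ G.Adj z n := by
  set S := NB G z with hS
  obtain ⟨f, hf, hmax⟩ := Finset.exists_max_image
    (Finset.univ.filter fun f => J G (S \ R) k f) (fun f => (gr G S).dist v f)
    ⟨k, by simpa using J.refl k⟩
  simp only [Finset.mem_filter, Finset.mem_univ, true_and] at hf hmax
  have hfS : f ∈ S \ R := hf.mem hk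
  have hvf : v ≠ f := by rintro rfl; exact hfS.2 hvR
  have hSc : Conn G S := by obtain ⟨_, _, _, _, _, _, h⟩ := hz; exact h
  have hconn : Conn G (S \ {f}) := by
    refine conn_of_root v ⟨hv, hvf⟩ ?_
    have key : ∀ m, ∀ u, (gr G S).dist v u = m → u ∈ S \ {f} → J G (S \ {f}) v u := by
      intro m
      induction m using Nat.strong_induction_on with
      | _ m ih =>
        intro u hum hu
        by_cases huv : u = v
        · subst huv; exact J.refl _
        have hr : (gr G S).Reachable u v := hSc.2 u hu.1 v hv
        obtain ⟨p, hp⟩ := hr.exists_walk_length_eq_dist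
        cases p with
        | nil => exact absurd rfl huv
        | @cons _ u' _ h q =>
          rw [Walk.length_cons] at hp
          have h1 := dist_le q
          have h2 : (gr G S).dist v u' < m := by
            rw [← hum, dist_comm, dist_comm (u := v)]; omega
          by_cases hu'f : u' = f
          · exfalso
            subst hu'f
            have h3 : 0 < (gr G S).dist v u' :=
              Reachable.pos_dist_of_ne (hSc.2 v hv u' hfS.1) hvf
            have huR : u ∉ R := by
              intro huR
              rcases hR u huR with h4 | h4
              · exact huv h4
              · have h5 : (gr G S).Adj v u := ⟨hv, hu.1, h4⟩
                rw [dist_eq_one_iff_adj.2 h5] at hum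
                omega
            have := hmax u (hf.trans (J.adj hfS ⟨hu.1, huR⟩ h.2.2.symm))
            omega
          · exact (ih _ h2 u' rfl ⟨h.2.1, hu'f⟩).trans (J.adj ⟨h.2.1, hu'f⟩ hu h.2.2.symm)
    exact fun u hu => key _ u rfl hu
  have hnf : ¬ Far G f z := fun h => cut hG hT hg hz h hconn
  have hnf2 : ∃ n, G.Adj f n ∧ G.Adj z n := by
    by_contra hno
    push Not at hno
    exact hnf ⟨hfS.1.1, fun h => hfS.1.2 h.symm, hno⟩
  obtain ⟨n, hn1, hn2⟩ := hnf2
  exact ⟨f, n, hf, hn1, hn2⟩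

theorem claim2 {G : SimpleGraph V} (hG : G.Connected) (hT : TF G) (hg : InGcs G) {z v : V}
    (hz : ZT G z) (hv : Far G v z) : ZT G v := by
  have hvS : v ∈ NB G z := ⟨hv.1, fun h => hv.2.1 h.symm⟩
  have hzv : z ∈ NB G v := ⟨hv.1.symm, hv.2.1⟩
  have hSc : Conn G (NB G z) := by obtain ⟨_, _, _, _, _, _, h⟩ := hz; exact h
  have hcut := cut hG hT hg hz hv
  have hnN : ∀ n, G.Adj z n → n ∈ NB G v := fun n hn =>
    ⟨by rintro rfl; exact hvS.2 hn, fun h => hv.2.2 n h hn⟩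
  have hW : Conn G (NB G v) := by
    refine conn_of_root z hzv fun u hu => ?_
    by_cases huz : u = z
    · subst huz; exact J.refl _
    by_cases hzu : G.Adj z u
    · exact J.adj hzv hu hzu
    have huS : u ∈ NB G z \ {r | r = v ∨ G.Adj v r} := ⟨⟨huz, hzu⟩, fun h => h.elim hu.1 hu.2⟩
    obtain ⟨f, n, hf, hfn, hzn⟩ := noncut hG hT hg hz (R := {r | r = v ∨ G.Adj v r}) hvS
      (Or.inl rfl) (fun _ h => h) huS
    have hsub : NB G z \ {r | r = v ∨ G.Adj v r} ⊆ NB G v :=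
      fun r hr => ⟨fun h => hr.2 (Or.inl h), fun h => hr.2 (Or.inr h)⟩
    have hfv : f ∈ NB G v := hsub (hf.mem huS)
    exact ((J.adj hzv (hnN n hzn) hzn).trans (J.adj (hnN n hzn) hfv hfn.symm)).trans
      (hf.mono hsub).symm
  have hn : ∀ n, G.Adj v n → ∃ y ∈ NB G v, G.Adj n y := by
    intro n hvn
    by_contra hno
    push Not at hno
    have hN : ∀ y, G.Adj n y → y = v := by
      intro y hny
      by_contra hyv
      by_cases h : G.Adj v y
      · exact hT v n y hvn h hny
      · exact hno y ⟨hyv, h⟩ hny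
    have hfar : Far G n z := by
      refine ⟨?_, ?_, ?_⟩
      · rintro rfl; exact hv.2.1 hvn
      · intro h; exact hv.1 (hN z h).symm
      · intro m hm hzm
        rw [hN m hm] at hzm
        exact hvS.2 hzm
    refine cut hG hT hg hz hfar (reroute hSc (conn_singleton G v) ?_ (fun y _ h => hN y h))
    rintro y rfl
    exact ⟨hvS, hvn.ne⟩
  rcases lemmaDeg hG hT hg hW hn with ⟨a, ha, ha'⟩ | h
  · exfalso
    refine hcut (reroute hSc (conn_singleton G a) ?_ (fun y _ h => ha' y h))
    rintro y rfl
    exact ⟨⟨by rintro rfl; exact hv.2.1 ha, hv.2.2 _ ha⟩, ha.ne.symm⟩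
  · exact h

theorem ZT.nbrs {G : SimpleGraph V} {a b c : V} (h : ZT G a) (hb : G.Adj a b) (hc : G.Adj a c)
    (hbc : b ≠ c) : ∀ m, G.Adj a m → m = b ∨ m = c := by
  obtain ⟨p, q, hpq, hp, hq, hN, _⟩ := h
  intro m hm
  have := hN m hm
  have := hN b hb
  have := hN c hc
  grind

theorem allZT {G : SimpleGraph V} (hG : G.Connected) (hT : TF G) (hg : InGcs G) {e x : V}
    (he : ZT G e) (hd : 4 ≤ G.dist e x) (v : V) : ZT G v := by
  have hdc : 4 ≤ G.dist x e := by rwa [dist_comm]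
  have hxe : Far G x e := far_of_dist (by omega)
  have hx : ZT G x := claim2 hG hT hg he hxe
  by_cases h1 : Far G v e
  · exact claim2 hG hT hg he h1
  by_cases h2 : Far G v x
  · exact claim2 hG hT hg hx h2
  have nbE : ∀ n, G.Adj e n → Far G n x := fun n hn => far_of_dist (by
    have := dist_step hG (c := x) hn
    omega)
  have nbX : ∀ n, G.Adj x n → Far G n e := fun n hn => far_of_dist (by
    have := dist_step hG (c := e) hn
    omega)
  by_cases hve : v = e
  · rwa [hve]
  by_cases hvx : v = x
  · rwa [hvx]
  have hnve : ¬ G.Adj v e := fun h => h2 (nbE v h.symm)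
  have hnvx : ¬ G.Adj v x := fun h => h1 (nbX v h.symm)
  have h1' : ∃ n, G.Adj v n ∧ G.Adj e n := by
    by_contra hno
    push Not at hno
    exact h1 ⟨hve, hnve, hno⟩
  have h2' : ∃ n, G.Adj v n ∧ G.Adj x n := by
    by_contra hno
    push Not at hno
    exact h2 ⟨hvx, hnvx, hno⟩
  obtain ⟨e1, hve1, hee1⟩ := h1'
  obtain ⟨x1, hvx1, hxx1⟩ := h2'
  have hx2 : ∃ x2, G.Adj x x2 ∧ x2 ≠ x1 := by
    obtain ⟨p, q, hpq, hp, hq, hN, _⟩ := hx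
    by_cases h : p = x1
    · exact ⟨q, hq, by rintro rfl; exact hpq h⟩
    · exact ⟨p, hp, h⟩
  obtain ⟨x2, hxx2, hx21⟩ := hx2
  have hNx := hx.nbrs hxx1 hxx2 hx21.symm
  have hZe1 : ZT G e1 := claim2 hG hT hg hx (nbE e1 hee1)
  have hNe1 := hZe1.nbrs hee1.symm hve1.symm (Ne.symm hve)
  have inS : ∀ n, Far G n e → n ∈ NB G e := fun n h => ⟨h.1, fun h' => h.2.1 h'.symm⟩
  have hSc : Conn G (NB G e) := by obtain ⟨_, _, _, _, _, _, h⟩ := he; exact h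
  have hx1S : x1 ∈ NB G e \ {x} := ⟨inS _ (nbX _ hxx1), hxx1.ne.symm⟩
  have hx2S : x2 ∈ NB G e \ {x} := ⟨inS _ (nbX _ hxx2), hxx2.ne.symm⟩
  have hnJ : ¬ J G (NB G e \ {x}) x1 x2 := by
    intro hJ
    refine cut hG hT hg he hxe (reroute hSc (conn_comp G (S := NB G e \ {x}) x1)
      (fun y hy => J.mem hy hx1S) ?_)
    intro y _ hy
    rcases hNx y hy with rfl | rfl
    · exact J.refl _
    · exact hJ
  obtain ⟨f, n, hf, hfn, hen⟩ := noncut hG hT hg he (R := {x}) (inS x hxe) rfl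
    (fun r h => Or.inl h) hx2S
  have hvS : v ∈ NB G e \ {x} := ⟨⟨hve, fun h => hnve h.symm⟩, hvx⟩
  have hfS : f ∈ NB G e \ {x} := hf.mem hx2S
  have hJv : J G (NB G e \ {x}) x1 v := J.adj hx1S hvS hvx1.symm
  have hfv : f ≠ v := by
    rintro rfl
    exact hnJ (hJv.trans hf.symm)
  have hnfv : ¬ G.Adj v f := fun h => hnJ ((hJv.trans (J.adj hvS hfS h)).trans hf.symm)
  have hZn : ZT G n := claim2 hG hT hg hx (nbE n hen)
  have hNn := hZn.nbrs hen.symm hfn.symm (Ne.symm hfS.1.1)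
  refine claim2 hG hT hg hZn ⟨?_, ?_, ?_⟩
  · rintro rfl; exact hnve hen.symm
  · intro h
    rcases hNn v h.symm with h | h
    · exact hve h
    · exact hfv h.symm
  · intro m hm hnm
    rcases hNn m hnm with rfl | rfl
    · exact hnve hm
    · exact hnfv hm

theorem main1 {G : SimpleGraph V} (hG : G.Connected) (hT : TF G) (hg : InGcs G) {a y : V}
    (hd : 4 ≤ G.dist a y) (v : V) : ZT G v := by
  obtain ⟨c, hc, hc'⟩ := lemmaE hG hT hg hd
  rcases hc' with hPc | hZ
  swap
  · exact allZT hG hT hg hZ hc v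
  obtain ⟨e, he, he'⟩ := lemmaE hG hT hg (by rwa [dist_comm] at hc : 4 ≤ G.dist y c)
  rcases he' with hPe | hZ
  swap
  · exact allZT hG hT hg hZ he v
  exfalso
  obtain ⟨x, X, x', hxX, hX, hNx, hxx, hXc⟩ := hPc
  obtain ⟨z, Y, z', hzY, hY, hNz, hzz, hYc⟩ := hPe
  have hec : e ≠ c := by rintro rfl; simp at he
  refine lemmaP hG hxX hzY hX hY hNx hNz hxx hzz ?_ hg
  intro a ha b hb
  have n1 : ¬ G.Adj e c := fun h => by rw [dist_eq_one_iff_adj.2 h] at he; omega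
  have n2 : ∀ m, G.Adj e m → ¬ G.Adj c m := fun m h h' => by
    have := dist2 h h'.symm; omega
  have n3 : ∀ m m', G.Adj e m → G.Adj c m' → ¬ G.Adj m m' := fun m m' h h' h3 => by
    have := dist3 h h3 h'.symm; omega
  constructor
  · rintro rfl
    rcases hXc a ha with h1 | h1 <;> rcases hYc a hb with h2 | h2
    · exact n2 a h2 h1
    · exact n1 (h2 c h1.symm)
    · exact n1 (h1 e h2.symm).symm
    · have : ∃ m, G.Adj a m := by
        by_cases hae : a = e
        · subst hae; exact exists_nbr hG hec
        · exact exists_nbr hG hae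
      obtain ⟨m, hm⟩ := this
      exact n2 m (h2 m hm) (h1 m hm)
  · intro hab
    rcases hXc a ha with h1 | h1 <;> rcases hYc b hb with h2 | h2
    · exact n3 b a h2 h1 hab.symm
    · exact n2 a (h2 a hab.symm) h1
    · exact n2 b h2 (h1 b hab)
    · exact n3 a b (h2 a hab.symm) (h1 b hab) hab

theorem ending {G : SimpleGraph V} (hG : G.Connected) (hall : ∀ v, ZT G v) :
    ∃ n, Nonempty (G ≃g cycleGraph n) := by
  have hnb : ∀ a b c, G.Adj a b → G.Adj a c → b ≠ c → ∀ m, G.Adj a m → m = b ∨ m = c :=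
    fun a b c h1 h2 h3 => (hall a).nbrs h1 h2 h3
  have hnac : ¬ G.IsAcyclic := by
    intro hac
    have ht : G.IsTree := ⟨hG, hac⟩
    obtain ⟨v0⟩ := hG.nonempty
    obtain ⟨p, q, hpq, hp, _⟩ := hall v0
    haveI : Nontrivial V := ⟨p, q, hpq⟩
    obtain ⟨v, hv⟩ := ht.exists_vert_degree_one_of_nontrivial
    obtain ⟨p, q, hpq, hp, hq, _⟩ := hall v
    rw [degree_eq_one_iff_existsUnique_adj] at hv
    exact hpq (hv.unique hp hq)
  rw [isAcyclic_iff_free_cycleGraph] at hnac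
  push Not at hnac
  obtain ⟨n, hn, hfree⟩ := hnac
  obtain ⟨f⟩ := hfree
  obtain ⟨m, rfl⟩ : ∃ m, n = m + 3 := ⟨n - 3, by omega⟩
  have hinj : Function.Injective f := f.injective
  have hhom : ∀ i j, (cycleGraph (m + 3)).Adj i j → G.Adj (f i) (f j) := fun i j h => f.toHom.map_adj h
  have hnbr : ∀ i y, G.Adj (f i) y → ∃ j, (cycleGraph (m + 3)).Adj i j ∧ f j = y := by
    intro i y hy
    have h1 : (cycleGraph (m + 3)).Adj i (i + 1) := by
      rw [cycleGraph_adj]; simp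
    have h2 : (cycleGraph (m + 3)).Adj i (i - 1) := by
      rw [cycleGraph_adj]; simp
    have h3 : f (i + 1) ≠ f (i - 1) := by
      intro h
      have := hinj h
      have hd := cycleGraph_degree_three_le (n := m) (v := i)
      rw [← card_neighborFinset_eq_degree, cycleGraph_neighborFinset, this] at hd
      simp at hd
    rcases hnb _ _ _ (hhom _ _ h1) (hhom _ _ h2) h3 y hy with h | h
    · exact ⟨_, h1, h.symm⟩
    · exact ⟨_, h2, h.symm⟩
  have hsurj : Function.Surjective f := by
    intro y
    by_contra hy
    obtain ⟨u, ⟨i, rfl⟩, v, hv, huv⟩ := exists_edge hG (T := Set.range f) (a := f 0) (b := y)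
      ⟨0, rfl⟩ (fun ⟨j, hj⟩ => hy ⟨j, hj⟩)
    obtain ⟨j, _, hj⟩ := hnbr i v huv
    exact hv ⟨j, hj⟩
  refine ⟨m + 3, ⟨RelIso.symm ⟨Equiv.ofBijective f ⟨hinj, hsurj⟩, ?_⟩⟩⟩
  intro i j
  constructor
  · intro h
    obtain ⟨k, hk, hk'⟩ := hnbr i (f j) h
    rwa [← hinj hk']
  · exact hhom i j

theorem stmt_17 (G : SimpleGraph V) (hG : G.Connected) (htf : G.CliqueFree 3)
    (hGcs : InGcs G) (hnc : ∀ n : ℕ, IsEmpty (G ≃g cycleGraph n)) :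
    ∀ u v : V, G.dist u v ≤ 3 := by
  have hT : TF G := by
    intro a b c hab hac hbc
    exact htf {a, b, c} (is3Clique_triple_iff.2 ⟨hab, hac, hbc⟩)
  intro u v
  by_contra h
  obtain ⟨n, ⟨φ⟩⟩ := ending hG (fun x => main1 hG hT hGcs (a := u) (y := v) (by omega) x)
  exact (hnc n).false φ
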